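/- Let P̄ be a Markov kernel on a finite set V̄, let Ḡ be a subgroup of S_{P̄}, let ≡ be the equivalence relation on V̄ given by x̄ ≡ ȳ ⇔ ∃ g ∈ Ḡ with g(x̄) = ȳ, let V be the set of equivalence classes with projection π : V̄ → V, and let P be the Markov kernel on V defined by P(x,y) = P̄(x̄, π^{-1}(y)) for any x̄ ∈ V̄ with π(x̄) = x (this does not depend on the choice of x̄). If P̄ is uniplicit and H(P̄) ≠ ∅, then P is uniplicit and H(P) ≠ ∅. -/

import Mathlib

open scoped BigOperators

/-- A Markov kernel on a finite set `V`: nonnegative entries, row sums equal to 1. -/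
def IsMarkov {V : Type*} [Fintype V] (P : Matrix V V ℝ) : Prop :=
  (∀ x y, 0 ≤ P x y) ∧ ∀ x, ∑ y, P x y = 1

/-- Irreducibility: all entries of `∑_{n=1}^{|V|} P^n` are positive. -/
def IsIrreducibleKernel {V : Type*} [Fintype V] [DecidableEq V] (P : Matrix V V ℝ) : Prop :=
  ∀ x y, 0 < ∑ n ∈ Finset.Icc 1 (Fintype.card V), (P ^ n) x y

/-- A probability measure on `V`, seen as a nonnegative vector of total mass 1. -/
def IsProbVec {V : Type*} [Fintype V] (m : V → ℝ) : Prop :=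
  (∀ x, 0 ≤ m x) ∧ ∑ x, m x = 1

/-- A probability measure positive on all points of `V`. -/
def IsPositiveProb {V : Type*} [Fintype V] (μ : V → ℝ) : Prop :=
  (∀ x, 0 < μ x) ∧ ∑ x, μ x = 1

/-- Reversibility of `P` with respect to `μ`. -/
def IsReversible {V : Type*} (P : Matrix V V ℝ) (μ : V → ℝ) : Prop :=
  ∀ x y, μ x * P x y = μ y * P y x

/-- `P` is uniplicit: reversible with respect to some positive probability, and all its
eigenvalues have multiplicity 1 (every eigenspace has dimension at most one). -/
def Uniplicit {V : Type*} [Fintype V] (P : Matrix V V ℝ) : Prop :=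
  (∃ μ : V → ℝ, IsPositiveProb μ ∧ IsReversible P μ) ∧
  ∀ (θ : ℝ) (f g : V → ℝ), P.mulVec f = θ • f → P.mulVec g = θ • g →
    ∃ a b : ℝ, (a ≠ 0 ∨ b ≠ 0) ∧ a • f = b • g

/-- The Markov commutator of `P`: the Markov kernels commuting with `P`. -/
def MarkovCommutator {V : Type*} [Fintype V] (P : Matrix V V ℝ) : Set (Matrix V V ℝ) :=
  {K | IsMarkov K ∧ K * P = P * K}

/-- `K(P,x)`: the set of rows at `x` of elements of the Markov commutator of `P`. -/
def commRows {V : Type*} [Fintype V] (P : Matrix V V ℝ) (x : V) : Set (V → ℝ) :=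
  {m | ∃ K ∈ MarkovCommutator P, m = fun y => K x y}

/-- `H(P) := {x : K(P,x) = P(V)}`. -/
def HSet {V : Type*} [Fintype V] (P : Matrix V V ℝ) : Set V :=
  {x | commRows P x = {m | IsProbVec m}}

/-- The hypergroup property of `P` with respect to `μ` and the point `x0`. -/
def HypergroupProperty {V : Type*} [Fintype V]
    (P : Matrix V V ℝ) (μ : V → ℝ) (x0 : V) : Prop :=
  ∃ φ : Fin (Fintype.card V) → V → ℝ,
    (∃ k1, ∀ x, φ k1 x = 1) ∧
    (∀ k l, ∑ x, μ x * φ k x * φ l x = if k = l then 1 else 0) ∧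
    (∀ k, ∃ θ : ℝ, ∀ x, ∑ y, P x y * φ k y = θ * φ k x) ∧
    (∀ k, φ k x0 ≠ 0) ∧
    ∀ x y z, 0 ≤ ∑ k, φ k x * φ k y * φ k z / φ k x0

/-- `g` is a symmetry of `P`. -/
def IsSymmetry {V : Type*} (P : Matrix V V ℝ) (g : Equiv.Perm V) : Prop :=
  ∀ x y, P (g x) (g y) = P x y

/-- A matrix that kills all eigenvectors of a reversible kernel is zero. -/
theorem eq_zero_of_mulVec_eigenvector_eq_zero {V : Type*} [Fintype V] [DecidableEq V]
    {P : Matrix V V ℝ} {μ : V → ℝ} (hμ : ∀ x, 0 < μ x) (hP : IsReversible P μ)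
    {M : Matrix V V ℝ} (hM : ∀ (θ : ℝ) (f : V → ℝ), P.mulVec f = θ • f → M.mulVec f = 0) :
    M = 0 := by
  have hs : ∀ x, √(μ x) ≠ 0 := fun x => (Real.sqrt_pos.2 (hμ x)).ne'
  have hsq : ∀ x, √(μ x) * √(μ x) = μ x := fun x => Real.mul_self_sqrt (hμ x).le
  let S : Matrix V V ℝ := Matrix.of fun x y => √(μ x) * P x y / √(μ y)
  have hS : S.IsHermitian := by
    ext x y
    simp only [S, Matrix.conjTranspose_apply, Matrix.of_apply, star_trivial]
    rw [div_eq_div_iff (hs x) (hs y)]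
    have h := hP x y
    rw [← hsq x, ← hsq y] at h
    linarith
  let N : Matrix V V ℝ := Matrix.of fun x y => M x y / √(μ y)
  have hN : N = 0 := by
    have hzero : ∀ i, N.mulVec (hS.eigenvectorBasis i).ofLp = 0 := by
      intro i
      have hv := hS.mulVec_eigenvectorBasis i
      set v : V → ℝ := (hS.eigenvectorBasis i).ofLp
      have hNM : N.mulVec v = M.mulVec fun x => v x / √(μ x) := by
        ext x
        simp only [N, Matrix.mulVec, dotProduct, Matrix.of_apply]
        exact Finset.sum_congr rfl fun y _ => by ring
      rw [hNM]
      refine hM (hS.eigenvalues i) _ ?_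
      ext x
      have hx := congrFun hv x
      simp only [S, Matrix.mulVec, dotProduct, Matrix.of_apply, Pi.smul_apply, smul_eq_mul]
        at hx ⊢
      rw [← mul_div_assoc, ← hx, eq_div_iff (hs x), Finset.sum_mul]
      exact Finset.sum_congr rfl fun y _ => by ring
    have hlin : (Matrix.toEuclideanLin N) = 0 := by
      refine hS.eigenvectorBasis.toBasis.ext fun i => ?_
      ext x
      simpa [Matrix.toLpLin_apply] using congrFun (hzero i) x
    exact (LinearEquiv.map_eq_zero_iff _).1 hlin
  ext x y
  have h := congrFun (congrFun hN x) y
  simpa [N, hs y] using h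

/-- A matrix commuting with a uniplicit kernel preserves its eigenlines. -/
theorem Uniplicit.exists_mulVec_eq_smul {V : Type*} [Fintype V] {P : Matrix V V ℝ}
    (hP : Uniplicit P) {A : Matrix V V ℝ} (hA : A * P = P * A) {θ : ℝ} {f : V → ℝ}
    (hf : P.mulVec f = θ • f) : ∃ α : ℝ, A.mulVec f = α • f := by
  by_cases hf0 : f = 0
  · exact ⟨0, by simp [hf0]⟩
  have hAf : P.mulVec (A.mulVec f) = θ • A.mulVec f := by
    rw [Matrix.mulVec_mulVec, ← hA, ← Matrix.mulVec_mulVec, hf, Matrix.mulVec_smul]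
  obtain ⟨a, b, hab, h⟩ := hP.2 θ f (A.mulVec f) hf hAf
  have hb : b ≠ 0 := by
    rintro rfl
    rw [zero_smul, smul_eq_zero] at h
    simp_all
  exact ⟨b⁻¹ * a, by rw [mul_smul, h, inv_smul_smul₀ hb]⟩

/-- The commutant of a uniplicit kernel is commutative. -/
theorem Uniplicit.mul_comm_of_commute {V : Type*} [Fintype V] [DecidableEq V]
    {P : Matrix V V ℝ} (hP : Uniplicit P) {A B : Matrix V V ℝ}
    (hA : A * P = P * A) (hB : B * P = P * B) : A * B = B * A := by
  obtain ⟨μ, hμ, hrev⟩ := hP.1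
  refine sub_eq_zero.1 (eq_zero_of_mulVec_eigenvector_eq_zero hμ.1 hrev fun θ f hf => ?_)
  obtain ⟨α, hα⟩ := hP.exists_mulVec_eq_smul hA hf
  obtain ⟨β, hβ⟩ := hP.exists_mulVec_eq_smul hB hf
  rw [Matrix.sub_mulVec, ← Matrix.mulVec_mulVec, ← Matrix.mulVec_mulVec, hα, hβ,
    Matrix.mulVec_smul, Matrix.mulVec_smul, hα, hβ, smul_comm, sub_self]

/-- A symmetry of `P` is a symmetry of every matrix commuting with `P`, if `P` is uniplicit. -/
theorem IsSymmetry.of_commute {V : Type*} [Fintype V] [DecidableEq V]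
    {P : Matrix V V ℝ} (hP : Uniplicit P) {g : Equiv.Perm V} (hg : IsSymmetry P g)
    {K : Matrix V V ℝ} (hK : K * P = P * K) : IsSymmetry K g := by
  let T : Matrix V V ℝ := Matrix.of fun x y => if g x = y then 1 else 0
  have hleft : ∀ (A : Matrix V V ℝ) x y, (T * A) x y = A (g x) y := by
    intro A x y
    simp [T, Matrix.mul_apply]
  have hright : ∀ (A : Matrix V V ℝ) x y, (A * T) x (g y) = A x y := by
    intro A x y
    simp [T, Matrix.mul_apply]
  have hT : T * P = P * T := by
    ext x y
    obtain ⟨y, rfl⟩ := g.surjective y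
    rw [hleft, hright, hg]
  have h := hP.mul_comm_of_commute hT hK
  intro x y
  rw [← hleft K x, h, hright]

section Quotient

variable {Vb V : Type*} [Fintype Vb] [DecidableEq V] {π : Vb → V}

/-- Integrating a function on the quotient against a pushed-forward vector. -/
theorem sum_sum_fiber_mul [Fintype V] (π : Vb → V) (m : Vb → ℝ) (f : V → ℝ) :
    ∑ y, (∑ yb ∈ Finset.univ.filter (fun yb => π yb = y), m yb) * f y =
      ∑ yb, m yb * f (π yb) := by
  rw [← Finset.sum_fiberwise Finset.univ π]
  refine Finset.sum_congr rfl fun y _ => ?_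
  rw [Finset.sum_mul]
  refine Finset.sum_congr rfl fun yb hyb => ?_
  rw [(Finset.mem_filter.1 hyb).2]

/-- The matrix product is compatible with passing to quotient matrices. -/
theorem mul_apply_of_quotient [Fintype V] {Ab Bb : Matrix Vb Vb ℝ} {A B : Matrix V V ℝ}
    (hA : ∀ xb y, A (π xb) y = ∑ yb ∈ Finset.univ.filter (fun yb => π yb = y), Ab xb yb)
    (hB : ∀ xb y, B (π xb) y = ∑ yb ∈ Finset.univ.filter (fun yb => π yb = y), Bb xb yb)
    (xb : Vb) (z : V) :
    (A * B) (π xb) z = ∑ zb ∈ Finset.univ.filter (fun zb => π zb = z), (Ab * Bb) xb zb := by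
  simp only [Matrix.mul_apply, hA]
  rw [sum_sum_fiber_mul π (Ab xb) fun y => B y z, Finset.sum_comm]
  simp only [hB, Finset.mul_sum]

/-- The quotient of a Markov kernel is Markov. -/
theorem IsMarkov.of_quotient [Fintype V] (hπ : Function.Surjective π) {Kb : Matrix Vb Vb ℝ}
    {K : Matrix V V ℝ} (hKb : IsMarkov Kb)
    (hK : ∀ xb y, K (π xb) y = ∑ yb ∈ Finset.univ.filter (fun yb => π yb = y), Kb xb yb) :
    IsMarkov K := by
  refine ⟨fun x y => ?_, fun x => ?_⟩ <;> obtain ⟨xb, rfl⟩ := hπ x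
  · rw [hK]
    exact Finset.sum_nonneg fun yb _ => hKb.1 _ _
  · simp only [hK]
    rw [Finset.sum_fiberwise, hKb.2]

/-- A matrix invariant under a group acting transitively on the fibers descends to the
quotient. -/
theorem exists_quotient_matrix (hπ : Function.Surjective π) {G : Subgroup (Equiv.Perm Vb)}
    (hfib : ∀ xb yb : Vb, π xb = π yb ↔ ∃ g ∈ G, g xb = yb)
    {Kb : Matrix Vb Vb ℝ} (hKb : ∀ g ∈ G, IsSymmetry Kb g) :
    ∃ K : Matrix V V ℝ, ∀ xb y,
      K (π xb) y = ∑ yb ∈ Finset.univ.filter (fun yb => π yb = y), Kb xb yb := by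
  refine ⟨Matrix.of fun x y =>
    ∑ yb ∈ Finset.univ.filter (fun yb => π yb = y), Kb (Function.surjInv hπ x) yb,
    fun xb y => ?_⟩
  obtain ⟨g, hg, hgx⟩ := (hfib xb _).1 (Function.surjInv_eq hπ (π xb)).symm
  have hgπ : ∀ yb, π (g yb) = π yb := fun yb => ((hfib yb (g yb)).2 ⟨g, hg, rfl⟩).symm
  rw [Matrix.of_apply, ← hgx]
  refine (Finset.sum_equiv g (fun yb => ?_) fun yb _ => (hKb g hg xb yb).symm).symm
  simp [hgπ]

/-- The quotient of a uniplicit kernel is uniplicit. -/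
theorem Uniplicit.of_quotient [Fintype V] (hπ : Function.Surjective π) {Pb : Matrix Vb Vb ℝ}
    {P : Matrix V V ℝ} (huni : Uniplicit Pb)
    (hP : ∀ xb y, P (π xb) y = ∑ yb ∈ Finset.univ.filter (fun yb => π yb = y), Pb xb yb) :
    Uniplicit P := by
  obtain ⟨⟨μ, hμ, hrev⟩, hmult⟩ := huni
  refine ⟨⟨fun x => ∑ xb ∈ Finset.univ.filter (fun xb => π xb = x), μ xb,
    ⟨fun x => ?_, ?_⟩, fun x y => ?_⟩, fun θ f g hf hg => ?_⟩
  · obtain ⟨xb, rfl⟩ := hπ x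
    exact Finset.sum_pos (fun yb _ => hμ.1 yb) ⟨xb, by simp⟩
  · rw [Finset.sum_fiberwise, hμ.2]
  · have h : ∀ x y, (∑ xb ∈ Finset.univ.filter (fun xb => π xb = x), μ xb) * P x y =
        ∑ xb ∈ Finset.univ.filter (fun xb => π xb = x),
          ∑ yb ∈ Finset.univ.filter (fun yb => π yb = y), μ xb * Pb xb yb := by
      intro x y
      rw [Finset.sum_mul]
      refine Finset.sum_congr rfl fun xb hxb => ?_
      rw [← (Finset.mem_filter.1 hxb).2, hP, Finset.mul_sum]
    rw [h, h, Finset.sum_comm]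
    exact Finset.sum_congr rfl fun yb _ => Finset.sum_congr rfl fun xb _ => hrev xb yb
  · have hlift : ∀ f : V → ℝ, P.mulVec f = θ • f → Pb.mulVec (f ∘ π) = θ • (f ∘ π) := by
      intro f hf
      ext xb
      have h := congrFun hf (π xb)
      simp only [Matrix.mulVec, dotProduct, hP, Pi.smul_apply] at h
      rw [sum_sum_fiber_mul π (Pb xb) f] at h
      exact h
    obtain ⟨a, b, hab, h⟩ := hmult θ _ _ (hlift f hf) (hlift g hg)
    refine ⟨a, b, hab, funext fun x => ?_⟩
    obtain ⟨xb, rfl⟩ := hπ x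
    exact congrFun h xb

/-- Every probability vector on the quotient is the image of a probability vector. -/
theorem IsProbVec.exists_lift [Fintype V] (hπ : Function.Surjective π) {m : V → ℝ}
    (hm : IsProbVec m) : ∃ mb : Vb → ℝ, IsProbVec mb ∧
      ∀ y, ∑ yb ∈ Finset.univ.filter (fun yb => π yb = y), mb yb = m y := by
  classical
  let mb : Vb → ℝ := fun yb => if yb = Function.surjInv hπ (π yb) then m (π yb) else 0
  have hmb : ∀ y, ∑ yb ∈ Finset.univ.filter (fun yb => π yb = y), mb yb = m y := by
    intro y
    rw [Finset.sum_eq_single (Function.surjInv hπ y)]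
    · simp [mb, Function.surjInv_eq hπ]
    · intro yb hyb hne
      rw [← (Finset.mem_filter.1 hyb).2] at hne
      exact if_neg hne
    · intro h
      exact absurd (by simp [Function.surjInv_eq hπ]) h
  refine ⟨mb, ⟨fun yb => ?_, ?_⟩, hmb⟩
  · dsimp only [mb]
    split_ifs
    exacts [hm.1 _, le_rfl]
  · rw [← Finset.sum_fiberwise Finset.univ π]
    simp only [hmb, hm.2]

end Quotient

/-- Reduction of the symmetries: if `P̄` is an uniplicit Markov kernel on
`V̄` with `H(P̄) ≠ ∅`, `Ḡ` is a subgroup of its symmetry group, `π : V̄ → V` is the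
projection onto the set of equivalence classes of the orbit relation of `Ḡ`, and
`P(x,y) = P̄(x̄, π⁻¹(y))` for any `x̄` with `π(x̄) = x`, then `P` is uniplicit and
`H(P) ≠ ∅`. -/
theorem quotient_kernel_uniplicit_and_HSet_nonempty
    {Vb V : Type*} [Fintype Vb] [DecidableEq Vb] [Fintype V] [DecidableEq V]
    (Pb : Matrix Vb Vb ℝ) (hPb : IsMarkov Pb)
    (G : Subgroup (Equiv.Perm Vb)) (hG : ∀ g ∈ G, IsSymmetry Pb g)
    (π : Vb → V) (hπ : Function.Surjective π)
    (hfib : ∀ xb yb : Vb, π xb = π yb ↔ ∃ g ∈ G, g xb = yb)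
    (P : Matrix V V ℝ)
    (hPdef : ∀ (xb : Vb) (y : V),
      P (π xb) y = ∑ yb ∈ Finset.univ.filter (fun yb => π yb = y), Pb xb yb)
    (huni : Uniplicit Pb) (hH : (HSet Pb).Nonempty) :
    Uniplicit P ∧ (HSet P).Nonempty := by
  refine ⟨huni.of_quotient hπ hPdef, ?_⟩
  obtain ⟨xb, hxb⟩ := hH
  refine ⟨π xb, Set.Subset.antisymm ?_ fun m hm => ?_⟩
  · rintro _ ⟨K, hK, rfl⟩
    exact ⟨hK.1.1 _, hK.1.2 _⟩
  obtain ⟨mb, hmb, hmbm⟩ := IsProbVec.exists_lift hπ hm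
  obtain ⟨Kb, ⟨hKb, hcomm⟩, rfl⟩ : mb ∈ commRows Pb xb := hxb.symm.subset hmb
  obtain ⟨K, hK⟩ := exists_quotient_matrix hπ hfib
    fun g hg => (hG g hg).of_commute huni hcomm
  refine ⟨K, ⟨hKb.of_quotient hπ hK, ?_⟩, funext fun y => by rw [hK, hmbm]⟩
  ext x z
  obtain ⟨xb, rfl⟩ := hπ x
  rw [mul_apply_of_quotient hK hPdef, mul_apply_of_quotient hPdef hK, hcomm]
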